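/- Let σ > 0, l > 0, and define for t > 0 and 0 < x < l: u(t,x) = 1 + (2/π)·√(l/x)·Σ_{m=1}^{∞} ((−1)^m/m)·sin(πm·√(x/l))·exp(−σ²π²m²t/(8l)). Then: (i) the series converges for every t > 0 and x ∈ (0, l); (ii) u satisfies the PDE ∂u/∂t = (σ²/2)·x·∂²u/∂x² + (3σ²/4)·∂u/∂x at every (t, x) with t > 0 and 0 < x < l; (iii) u(t, x) → 1 as x → l for each fixed t > 0; and (iv) u(t, x) → 0 as t → 0⁺ for each fixed x ∈ (0, l). -/

import Mathlib

/-- The `m`-th term (with `m` running over `1, 2, …`, here encoded by `m + 1` for `m : ℕ`)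
of the Fourier–Bessel series for the first-passage-time distribution function,
specialized to `γ = −1/4`. -/
noncomputable def fbTerm (σ l t x : ℝ) (m : ℕ) : ℝ :=
  (-1 : ℝ) ^ (m + 1) / (m + 1) * Real.sin (Real.pi * (m + 1) * Real.sqrt (x / l)) *
    Real.exp (-(σ ^ 2 * Real.pi ^ 2 * (m + 1) ^ 2 * t) / (8 * l))

/-- The Fourier–Bessel series
`u(t,x) = 1 + (2/π)·√(l/x)·Σ_{m=1}^∞ ((−1)^m/m)·sin(πm√(x/l))·exp(−σ²π²m²t/(8l))`. -/
noncomputable def fbU (σ l t x : ℝ) : ℝ :=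
  1 + 2 / Real.pi * Real.sqrt (l / x) * ∑' m : ℕ, fbTerm σ l t x m

open Filter Topology

theorem Complex.tendsto_sum_pow_div_neg_log {z : ℂ} (hz : ‖z‖ ≤ 1) (hz1 : z ≠ 1) :
    Tendsto (fun n ↦ ∑ i ∈ Finset.range n, z ^ (i + 1) / (i + 1)) atTop
      (𝓝 (-Complex.log (1 - z))) := by
  have hbound (n : ℕ) : ‖∑ i ∈ Finset.range n, z ^ (i + 1)‖ ≤ 2 / ‖z - 1‖ := by
    simp_rw [pow_succ']
    rw [← Finset.mul_sum, geom_sum_eq hz1, norm_mul, norm_div]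
    have h1 : ‖z ^ n - 1‖ ≤ 2 := by
      refine (norm_sub_le _ _).trans ?_
      rw [norm_pow, norm_one]
      linarith [pow_le_one₀ (n := n) (norm_nonneg z) hz]
    calc ‖z‖ * (‖z ^ n - 1‖ / ‖z - 1‖) ≤ 1 * (2 / ‖z - 1‖) := by gcongr
      _ = _ := one_mul _
  have hanti : Antitone fun n : ℕ ↦ 1 / ((n : ℝ) + 1) := fun a b hab ↦ by
    dsimp only
    gcongr
  have hcauchy := hanti.cauchySeq_series_mul_of_tendsto_zero_of_bounded
    tendsto_one_div_add_atTop_nhds_zero_nat hbound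
  have hterm (i : ℕ) : (1 / ((i : ℝ) + 1)) • z ^ (i + 1) = z ^ (i + 1) / (i + 1) := by
    rw [Complex.real_smul]
    push_cast
    ring
  simp_rw [hterm] at hcauchy
  obtain ⟨L, hL⟩ := cauchySeq_tendsto_of_complete hcauchy
  have hslit : 1 - z ∈ Complex.slitPlane := by
    refine Or.inl ?_
    rw [Complex.sub_re, Complex.one_re, sub_pos]
    refine lt_of_le_of_ne ((Complex.re_le_norm z).trans hz) fun hre ↦ hz1 ?_
    have h2 : z.re * z.re + z.im * z.im ≤ 1 := by
      rw [← Complex.normSq_apply, Complex.normSq_eq_norm_sq]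
      exact pow_le_one₀ (norm_nonneg z) hz
    have him : z.im = 0 := by
      rw [hre] at h2
      nlinarith [mul_self_nonneg z.im]
    exact Complex.ext hre him
  have habel := Complex.tendsto_tsum_powerSeries_nhdsWithin_lt hL
  rw [tendsto_map'_iff] at habel
  have hid : Tendsto (fun r : ℝ ↦ (r : ℂ)) (𝓝[<] 1) (𝓝 1) := by
    simpa using (Complex.continuous_ofReal.tendsto 1).mono_left nhdsWithin_le_nhds
  have hlim := hid.mul habel
  rw [one_mul] at hlim
  have hlog : Tendsto (fun r : ℝ ↦ -Complex.log (1 - r * z)) (𝓝[<] 1)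
      (𝓝 (-Complex.log (1 - z))) := by
    have h3 : Tendsto (fun r : ℝ ↦ 1 - (r : ℂ) * z) (𝓝[<] 1) (𝓝 (1 - z)) := by
      simpa using tendsto_const_nhds.sub (hid.mul_const z)
    exact (h3.clog hslit).neg
  have heq : (fun r : ℝ ↦ -Complex.log (1 - r * z)) =ᶠ[𝓝[<] 1]
      fun r : ℝ ↦ (r : ℂ) * ∑' n : ℕ, z ^ (n + 1) / (n + 1) * (r : ℂ) ^ n := by
    filter_upwards [Ioo_mem_nhdsLT (zero_lt_one' ℝ)] with r hr
    have hrz : ‖(r : ℂ) * z‖ < 1 := by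
      rw [norm_mul, Complex.norm_real, Real.norm_of_nonneg hr.1.le]
      nlinarith [hr.1, hr.2, norm_nonneg z]
    rw [← (Complex.hasSum_taylorSeries_neg_log' hrz).tsum_eq, ← tsum_mul_left]
    refine tsum_congr fun n ↦ ?_
    rw [mul_pow]
    ring
  rwa [tendsto_nhds_unique hlog (hlim.congr' heq.symm)]

theorem Real.tendsto_sum_alternating_sin {y : ℝ} (hy0 : 0 < y) (hy1 : y < 1) :
    Tendsto (fun n ↦ ∑ m ∈ Finset.range n,
      (-1 : ℝ) ^ (m + 1) / (m + 1) * Real.sin (Real.pi * (m + 1) * y)) atTop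
      (𝓝 (-(Real.pi * y / 2))) := by
  set θ := Real.pi * y with hθ
  have hθ0 : 0 < θ := by positivity
  have hθ1 : θ < Real.pi := by nlinarith [Real.pi_pos]
  have hcos : 0 < Real.cos (θ / 2) :=
    Real.cos_pos_of_mem_Ioo ⟨by linarith, by linarith⟩
  set z : ℂ := -Complex.exp (θ * Complex.I) with hz
  have hone : 1 - z = ((2 * Real.cos (θ / 2) : ℝ) : ℂ) *
      (Complex.cos ((θ / 2 : ℝ) : ℂ) + Complex.sin ((θ / 2 : ℝ) : ℂ) * Complex.I) := by
    have hd : (θ : ℂ) = 2 * ((θ / 2 : ℝ) : ℂ) := by push_cast; ring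
    rw [hz, Complex.exp_mul_I, hd, Complex.cos_two_mul, Complex.sin_two_mul]
    push_cast
    ring
  have harg : (Complex.log (1 - z)).im = θ / 2 := by
    rw [Complex.log_im, hone, Complex.arg_mul_cos_add_sin_mul_I (by positivity)
      ⟨by linarith, by linarith⟩]
  have hz1 : z ≠ 1 := by
    intro h
    have h0 : (Complex.log (1 - z)).im = 0 := by simp [h]
    linarith
  have hnorm : ‖z‖ ≤ 1 := by rw [hz, norm_neg, Complex.norm_exp_ofReal_mul_I]
  have hlim := (Complex.continuous_im.tendsto _).comp
    (Complex.tendsto_sum_pow_div_neg_log hnorm hz1)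
  rw [Complex.neg_im, harg] at hlim
  refine hlim.congr fun n ↦ ?_
  rw [Function.comp_apply, Complex.im_sum]
  refine Finset.sum_congr rfl fun m _ ↦ ?_
  have hpow : z ^ (m + 1) / ((m : ℂ) + 1) =
      (((-1 : ℝ) ^ (m + 1) / (m + 1) : ℝ) : ℂ) *
        Complex.exp ((Real.pi * (m + 1) * y : ℝ) * Complex.I) := by
    rw [hz, neg_pow, ← Complex.exp_nat_mul]
    have he : ((m + 1 : ℕ) : ℂ) * (θ * Complex.I) =
        (Real.pi * (m + 1) * y : ℝ) * Complex.I := by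
      rw [hθ]; push_cast; ring
    rw [he]
    push_cast
    ring
  rw [hpow, Complex.im_ofReal_mul, Complex.exp_ofReal_mul_I_im]

/-- A regular summation method given by antitone weights sums a convergent series to its limit. -/
theorem tendsto_tsum_mul_of_antitone {ι : Type*} {F : Filter ι} {a : ℕ → ℝ} {w : ι → ℕ → ℝ}
    {s : ℝ} (ha : Tendsto (fun n ↦ ∑ i ∈ Finset.range n, a i) atTop (𝓝 s))
    (hanti : ∀ᶠ t in F, Antitone (w t)) (hzero : ∀ᶠ t in F, Tendsto (w t) atTop (𝓝 0))
    (hsum : ∀ᶠ t in F, Summable fun n ↦ a n * w t n)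
    (hone : ∀ n, Tendsto (fun t ↦ w t n) F (𝓝 1)) :
    Tendsto (fun t ↦ ∑' n, a n * w t n) F (𝓝 s) := by
  set r : ℕ → ℝ := fun n ↦ ∑ i ∈ Finset.range n, a i - s with hr
  have hr0 : Tendsto r atTop (𝓝 0) := by simpa using ha.sub_const s
  have hparts (v : ℕ → ℝ) (N : ℕ) : ∑ i ∈ Finset.range N, a i * v i =
      s * v 0 + r N * v N + ∑ i ∈ Finset.range N, r (i + 1) * (v i - v (i + 1)) := by
    induction N with
    | zero => simp [hr]
    | succ n ih =>
      have hrn : r (n + 1) = r n + a n := by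
        simp only [hr, Finset.sum_range_succ]; ring
      rw [Finset.sum_range_succ, ih, Finset.sum_range_succ, hrn]
      ring
  rw [Metric.tendsto_nhds]
  intro ε hε
  obtain ⟨K, hK⟩ := Metric.tendsto_atTop.1 hr0 (ε / 4) (by positivity)
  have hK' (n : ℕ) (hn : K ≤ n) : |r n| ≤ ε / 4 := by
    simpa [Real.dist_eq] using (hK n hn).le
  have hhead : Tendsto (fun t ↦ |s * w t 0 - s| +
      ∑ i ∈ Finset.range K, |r (i + 1)| * (w t i - w t (i + 1))) F (𝓝 0) := by
    have h1 : Tendsto (fun t ↦ |s * w t 0 - s|) F (𝓝 0) := by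
      simpa using (((hone 0).const_mul s).sub_const s).abs
    have h2 : Tendsto (fun t ↦ ∑ i ∈ Finset.range K, |r (i + 1)| * (w t i - w t (i + 1))) F
        (𝓝 0) := by
      simpa using tendsto_finsetSum (Finset.range K) fun i _ ↦
        ((hone i).sub (hone (i + 1))).const_mul |r (i + 1)|
    simpa using h1.add h2
  have hKlt : ∀ᶠ t in F, w t K < 2 := (hone K).eventually_lt_const one_lt_two
  filter_upwards [hanti, hzero, hsum, hKlt,
    hhead.eventually_lt_const (show (0 : ℝ) < ε / 4 by positivity)] with t hat hzt hst hwK hht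
  have hw0 (n : ℕ) : 0 ≤ w t n := hat.le_of_tendsto hzt n
  have hpart (N : ℕ) (hN : K ≤ N) :
      |∑ i ∈ Finset.range N, a i * w t i - s| ≤ ε / 4 + ε / 4 * 2 + |r N * w t N| := by
    have htail : |∑ i ∈ Finset.Ico K N, r (i + 1) * (w t i - w t (i + 1))| ≤ ε / 4 * 2 := by
      calc |∑ i ∈ Finset.Ico K N, r (i + 1) * (w t i - w t (i + 1))|
          ≤ ∑ i ∈ Finset.Ico K N, ε / 4 * (w t i - w t (i + 1)) := by
            refine (Finset.abs_sum_le_sum_abs _ _).trans (Finset.sum_le_sum fun i hi ↦ ?_)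
            have hd : 0 ≤ w t i - w t (i + 1) := sub_nonneg.2 (hat i.le_succ)
            rw [abs_mul, abs_of_nonneg hd]
            exact mul_le_mul_of_nonneg_right
              (hK' _ ((Finset.mem_Ico.1 hi).1.trans i.le_succ)) hd
        _ = ε / 4 * (w t K - w t N) := by
            rw [← Finset.mul_sum]
            congr 1
            have := Finset.sum_Ico_sub (w t) hN
            rw [← neg_sub (w t N), ← this, ← Finset.sum_neg_distrib]
            simp
        _ ≤ ε / 4 * 2 := by
            have := hw0 N
            gcongr
            linarith
    have hfirst : |∑ i ∈ Finset.range K, r (i + 1) * (w t i - w t (i + 1))| ≤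
        ∑ i ∈ Finset.range K, |r (i + 1)| * (w t i - w t (i + 1)) := by
      refine (Finset.abs_sum_le_sum_abs _ _).trans (Finset.sum_le_sum fun i _ ↦ ?_)
      rw [abs_mul, abs_of_nonneg (sub_nonneg.2 (hat i.le_succ))]
    rw [hparts, ← Finset.sum_range_add_sum_Ico _ hN]
    have := abs_le.1 htail
    have := abs_le.1 hfirst
    have := le_abs_self (s * w t 0 - s)
    have := neg_abs_le (s * w t 0 - s)
    have := le_abs_self (r N * w t N)
    have := neg_abs_le (r N * w t N)
    rw [abs_le]
    constructor <;> linarith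
  have hlim1 := ((hst.hasSum.tendsto_sum_nat).sub_const s).abs
  have hlim2 : Tendsto (fun N ↦ ε / 4 + ε / 4 * 2 + |r N * w t N|) atTop
      (𝓝 (ε / 4 + ε / 4 * 2)) := by
    simpa using tendsto_const_nhds.add (hr0.mul hzt).abs
  have hle := le_of_tendsto_of_tendsto hlim1 hlim2 (eventually_atTop.2 ⟨K, hpart⟩)
  rw [Real.dist_eq]
  linarith

theorem summable_succ_pow_mul_exp_neg_sq (k : ℕ) {a : ℝ} (ha : 0 < a) :
    Summable fun m : ℕ ↦ ((m : ℝ) + 1) ^ k * Real.exp (-(a * (m + 1) ^ 2)) := by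
  have h := (summable_nat_add_iff 1).2 (Real.summable_pow_mul_exp_neg_nat_mul k ha)
  refine Summable.of_nonneg_of_le (fun m ↦ by positivity) (fun m ↦ ?_) h
  push_cast
  gcongr
  nlinarith [mul_nonneg ha.le (Nat.cast_nonneg (α := ℝ) m),
    mul_nonneg (mul_nonneg ha.le (Nat.cast_nonneg (α := ℝ) m)) (Nat.cast_nonneg (α := ℝ) m)]

theorem summable_heat_term (k : ℕ) {a : ℝ} (ha : 0 < a) {b : ℕ → ℝ} {C : ℝ}
    (hb : ∀ m : ℕ, |b m| ≤ C * ((m : ℝ) + 1) ^ k) :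
    Summable fun m : ℕ ↦ b m * Real.exp (-(a * (m + 1) ^ 2)) := by
  refine Summable.of_norm_bounded ((summable_succ_pow_mul_exp_neg_sq k ha).mul_left C) fun m ↦ ?_
  rw [norm_mul, Real.norm_eq_abs, Real.norm_of_nonneg (Real.exp_pos _).le, ← mul_assoc]
  exact mul_le_mul_of_nonneg_right (hb m) (Real.exp_pos _).le

theorem abs_alternating_div_le (m : ℕ) : |(-1 : ℝ) ^ (m + 1) / (m + 1)| ≤ 1 := by
  have hm : (0 : ℝ) < m + 1 := by positivity
  rw [abs_div, abs_pow, abs_neg, abs_one, one_pow, abs_of_pos hm, div_le_one hm]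
  linarith [Nat.cast_nonneg (α := ℝ) m]

/-- The alternating sine series with Gaussian weights. -/
noncomputable def heatSine (a y : ℝ) : ℝ :=
  ∑' m : ℕ, (-1 : ℝ) ^ (m + 1) / (m + 1) * Real.sin (Real.pi * (m + 1) * y) *
    Real.exp (-(a * (m + 1) ^ 2))

/-- The first space derivative of `heatSine`. -/
noncomputable def heatSineDeriv (a y : ℝ) : ℝ :=
  ∑' m : ℕ, (-1 : ℝ) ^ (m + 1) * Real.pi * Real.cos (Real.pi * (m + 1) * y) *
    Real.exp (-(a * (m + 1) ^ 2))

/-- The derivative of `heatSine` in the time parameter. -/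
noncomputable def heatSineTimeDeriv (a y : ℝ) : ℝ :=
  ∑' m : ℕ, -((-1 : ℝ) ^ (m + 1) * (m + 1) * Real.sin (Real.pi * (m + 1) * y)) *
    Real.exp (-(a * (m + 1) ^ 2))

theorem summable_heatSine {a : ℝ} (ha : 0 < a) (y : ℝ) :
    Summable fun m : ℕ ↦ (-1 : ℝ) ^ (m + 1) / (m + 1) * Real.sin (Real.pi * (m + 1) * y) *
      Real.exp (-(a * (m + 1) ^ 2)) := by
  refine summable_heat_term 0 ha (C := 1) fun m ↦ ?_
  rw [abs_mul, pow_zero]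
  exact mul_le_mul (abs_alternating_div_le m) (Real.abs_sin_le_one _) (abs_nonneg _) zero_le_one

theorem summable_heatSineDeriv {a : ℝ} (ha : 0 < a) (y : ℝ) :
    Summable fun m : ℕ ↦ (-1 : ℝ) ^ (m + 1) * Real.pi * Real.cos (Real.pi * (m + 1) * y) *
      Real.exp (-(a * (m + 1) ^ 2)) := by
  refine summable_heat_term 0 ha (C := Real.pi) fun m ↦ ?_
  rw [abs_mul, abs_mul, abs_pow, abs_neg, abs_one, one_pow, one_mul, abs_of_pos Real.pi_pos,
    pow_zero]
  exact mul_le_mul_of_nonneg_left (Real.abs_cos_le_one _) Real.pi_pos.le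

theorem hasDerivAt_heatSine {a : ℝ} (ha : 0 < a) (y : ℝ) :
    HasDerivAt (heatSine a) (heatSineDeriv a y) y := by
  refine hasDerivAt_tsum
    (g := fun (m : ℕ) y ↦ (-1 : ℝ) ^ (m + 1) / (m + 1) * Real.sin (Real.pi * (m + 1) * y) *
      Real.exp (-(a * (m + 1) ^ 2)))
    (g' := fun (m : ℕ) y ↦ (-1 : ℝ) ^ (m + 1) * Real.pi * Real.cos (Real.pi * (m + 1) * y) *
      Real.exp (-(a * (m + 1) ^ 2)))
    ((summable_succ_pow_mul_exp_neg_sq 0 ha).mul_left Real.pi) (fun m y ↦ ?_) (fun m y ↦ ?_)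
    (summable_heatSine ha 0) y
  · have hm : (m : ℝ) + 1 ≠ 0 := by positivity
    refine (((((hasDerivAt_id y).const_mul (Real.pi * (m + 1))).sin).const_mul
      ((-1 : ℝ) ^ (m + 1) / (m + 1))).mul_const (Real.exp (-(a * (m + 1) ^ 2)))).congr_deriv ?_
    simp only [id]
    field_simp
  · rw [norm_mul, norm_mul, norm_mul, norm_pow, norm_neg, norm_one, one_pow, one_mul,
      Real.norm_of_nonneg Real.pi_pos.le, Real.norm_of_nonneg (Real.exp_pos _).le, pow_zero,
      one_mul]
    refine mul_le_mul_of_nonneg_right ?_ (Real.exp_pos _).le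
    exact mul_le_of_le_one_right Real.pi_pos.le (Real.abs_cos_le_one _)

theorem hasDerivAt_heatSineDeriv {a : ℝ} (ha : 0 < a) (y : ℝ) :
    HasDerivAt (heatSineDeriv a) (Real.pi ^ 2 * heatSineTimeDeriv a y) y := by
  rw [heatSineTimeDeriv, ← tsum_mul_left]
  refine hasDerivAt_tsum
    (g := fun (m : ℕ) y ↦ (-1 : ℝ) ^ (m + 1) * Real.pi * Real.cos (Real.pi * (m + 1) * y) *
      Real.exp (-(a * (m + 1) ^ 2)))
    (g' := fun (m : ℕ) y ↦ Real.pi ^ 2 * (-((-1 : ℝ) ^ (m + 1) * (m + 1) *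
      Real.sin (Real.pi * (m + 1) * y)) * Real.exp (-(a * (m + 1) ^ 2))))
    ((summable_succ_pow_mul_exp_neg_sq 1 ha).mul_left (Real.pi ^ 2)) (fun m y ↦ ?_)
    (fun m y ↦ ?_) (summable_heatSineDeriv ha 0) y
  · refine (((((hasDerivAt_id y).const_mul (Real.pi * (m + 1))).cos).const_mul
      ((-1 : ℝ) ^ (m + 1) * Real.pi)).mul_const (Real.exp (-(a * (m + 1) ^ 2)))).congr_deriv ?_
    simp only [id]
    ring
  · have hm : (0 : ℝ) ≤ m + 1 := by positivity
    rw [norm_mul, norm_mul, norm_neg, norm_mul, norm_mul, norm_pow (-1 : ℝ), norm_neg, norm_one,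
      one_pow, one_mul, Real.norm_of_nonneg hm, Real.norm_of_nonneg (Real.exp_pos _).le,
      Real.norm_of_nonneg (sq_nonneg Real.pi), pow_one]
    refine mul_le_mul_of_nonneg_left (mul_le_mul_of_nonneg_right ?_ (Real.exp_pos _).le)
      (sq_nonneg _)
    exact mul_le_of_le_one_right hm (Real.abs_sin_le_one _)

theorem hasDerivAt_heatSine_time {a : ℝ} (ha : 0 < a) (y : ℝ) :
    HasDerivAt (fun b ↦ heatSine b y) (heatSineTimeDeriv a y) a := by
  refine hasDerivAt_tsum_of_isPreconnected (t := Set.Ioi (a / 2)) (y₀ := a)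
    (g := fun (m : ℕ) b ↦ (-1 : ℝ) ^ (m + 1) / (m + 1) * Real.sin (Real.pi * (m + 1) * y) *
      Real.exp (-(b * (m + 1) ^ 2)))
    (g' := fun (m : ℕ) b ↦ -((-1 : ℝ) ^ (m + 1) * (m + 1) * Real.sin (Real.pi * (m + 1) * y)) *
      Real.exp (-(b * (m + 1) ^ 2)))
    (summable_succ_pow_mul_exp_neg_sq 1 (half_pos ha)) isOpen_Ioi isPreconnected_Ioi
    (fun m b _ ↦ ?_) (fun m b hb ↦ ?_) (half_lt_self ha) (summable_heatSine ha y)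
    (half_lt_self ha)
  · have hm : (m : ℝ) + 1 ≠ 0 := by positivity
    refine ((((hasDerivAt_id b).mul_const (((m : ℝ) + 1) ^ 2)).neg.exp).const_mul
      ((-1 : ℝ) ^ (m + 1) / (m + 1) * Real.sin (Real.pi * (m + 1) * y))).congr_deriv ?_
    simp only [id, Pi.neg_apply]
    field_simp
  · have hm : (0 : ℝ) ≤ m + 1 := by positivity
    rw [norm_mul, norm_neg, norm_mul, norm_mul, norm_pow, norm_neg, norm_one, one_pow, one_mul,
      Real.norm_of_nonneg hm, Real.norm_of_nonneg (Real.exp_pos _).le, pow_one]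
    refine mul_le_mul (mul_le_of_le_one_right hm (Real.abs_sin_le_one _)) ?_
      (Real.exp_pos _).le hm
    have : a / 2 ≤ b := (Set.mem_Ioi.1 hb).le
    gcongr

theorem heatSine_one (a : ℝ) : heatSine a 1 = 0 := by
  refine (tsum_congr fun m ↦ ?_).trans tsum_zero
  have h : Real.sin (Real.pi * (m + 1) * 1) = 0 := by
    have := Real.sin_nat_mul_pi (m + 1)
    push_cast at this
    rw [mul_one, mul_comm, this]
  rw [h, mul_zero, zero_mul]

theorem tendsto_heatSine_zero {y : ℝ} (hy0 : 0 < y) (hy1 : y < 1) :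
    Tendsto (fun a ↦ heatSine a y) (𝓝[>] 0) (𝓝 (-(Real.pi * y / 2))) := by
  have hpos : ∀ᶠ a : ℝ in 𝓝[>] 0, 0 < a := self_mem_nhdsWithin
  refine tendsto_tsum_mul_of_antitone (w := fun a m ↦ Real.exp (-(a * ((m : ℝ) + 1) ^ 2)))
    (Real.tendsto_sum_alternating_sin hy0 hy1) ?_ ?_ ?_ fun n ↦ ?_
  · filter_upwards [hpos] with a ha m n hmn
    dsimp only
    gcongr
  · filter_upwards [hpos] with a ha
    simpa using (summable_succ_pow_mul_exp_neg_sq 0 ha).tendsto_atTop_zero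
  · filter_upwards [hpos] with a ha using summable_heatSine ha y
  · have hc : Continuous fun a : ℝ ↦ Real.exp (-(a * ((n : ℝ) + 1) ^ 2)) := by fun_prop
    simpa using (hc.tendsto 0).mono_left nhdsWithin_le_nhds

theorem fbTerm_eq (σ l t x : ℝ) (m : ℕ) :
    fbTerm σ l t x m = (-1 : ℝ) ^ (m + 1) / (m + 1) *
      Real.sin (Real.pi * (m + 1) * Real.sqrt (x / l)) *
      Real.exp (-(σ ^ 2 * Real.pi ^ 2 / (8 * l) * t * (m + 1) ^ 2)) := by
  rw [fbTerm]
  congr 2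
  ring

theorem fbU_eq (σ l t x : ℝ) :
    fbU σ l t x = 1 + 2 / Real.pi * (Real.sqrt (x / l))⁻¹ *
      heatSine (σ ^ 2 * Real.pi ^ 2 / (8 * l) * t) (Real.sqrt (x / l)) := by
  rw [fbU, tsum_congr (fbTerm_eq σ l t x), heatSine, ← Real.sqrt_inv, inv_div]

theorem hasDerivAt_sqrt_div {l x : ℝ} (hl : 0 < l) (hx : 0 < x) :
    HasDerivAt (fun x ↦ Real.sqrt (x / l)) (1 / (2 * l * Real.sqrt (x / l))) x := by
  refine (((hasDerivAt_id x).div_const l).sqrt (div_pos hx hl).ne').congr_deriv ?_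
  simp only [id]
  field_simp

theorem hasDerivAt_fbU {σ l t x : ℝ} (hσ : 0 < σ) (hl : 0 < l) (ht : 0 < t) (hx : 0 < x) :
    HasDerivAt (fbU σ l t)
      (1 / (Real.pi * l) *
        (heatSineDeriv (σ ^ 2 * Real.pi ^ 2 / (8 * l) * t) (Real.sqrt (x / l)) /
            Real.sqrt (x / l) ^ 2 -
          heatSine (σ ^ 2 * Real.pi ^ 2 / (8 * l) * t) (Real.sqrt (x / l)) /
            Real.sqrt (x / l) ^ 3)) x := by
  have ha : 0 < σ ^ 2 * Real.pi ^ 2 / (8 * l) * t := by positivity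
  have hy : 0 < Real.sqrt (x / l) := Real.sqrt_pos.2 (div_pos hx hl)
  have hd := hasDerivAt_sqrt_div hl hx
  rw [show fbU σ l t = _ from funext (fbU_eq σ l t)]
  refine ((((hd.inv hy.ne').const_mul (2 / Real.pi)).mul
    ((hasDerivAt_heatSine ha _).comp x hd)).const_add 1).congr_deriv ?_
  simp only [Function.comp_apply, Pi.inv_apply]
  generalize Real.sqrt (x / l) = y at *
  field_simp
  ring

theorem hasDerivAt_deriv_fbU {σ l t x : ℝ} (hσ : 0 < σ) (hl : 0 < l) (ht : 0 < t) (hx : 0 < x) :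
    HasDerivAt (deriv (fbU σ l t))
      (1 / (2 * Real.pi * l ^ 2) *
        (Real.pi ^ 2 * heatSineTimeDeriv (σ ^ 2 * Real.pi ^ 2 / (8 * l) * t) (Real.sqrt (x / l)) /
            Real.sqrt (x / l) ^ 3 -
          3 * heatSineDeriv (σ ^ 2 * Real.pi ^ 2 / (8 * l) * t) (Real.sqrt (x / l)) /
            Real.sqrt (x / l) ^ 4 +
          3 * heatSine (σ ^ 2 * Real.pi ^ 2 / (8 * l) * t) (Real.sqrt (x / l)) /
            Real.sqrt (x / l) ^ 5)) x := by
  have ha : 0 < σ ^ 2 * Real.pi ^ 2 / (8 * l) * t := by positivity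
  have hy : 0 < Real.sqrt (x / l) := Real.sqrt_pos.2 (div_pos hx hl)
  have hd := hasDerivAt_sqrt_div hl hx
  refine HasDerivAt.congr_of_eventuallyEq ?_ (Filter.eventuallyEq_of_mem (Ioi_mem_nhds hx)
    fun z hz ↦ (hasDerivAt_fbU hσ hl ht hz).deriv)
  refine (((((hasDerivAt_heatSineDeriv ha _).comp x hd).div (hd.pow 2) (pow_pos hy _).ne').sub
    (((hasDerivAt_heatSine ha _).comp x hd).div (hd.pow 3) (pow_pos hy _).ne')).const_mul
    (1 / (Real.pi * l))).congr_deriv ?_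
  simp only [Function.comp_apply, Pi.pow_apply]
  generalize Real.sqrt (x / l) = y at *
  field_simp
  ring

theorem stmt_17 (σ l : ℝ) (hσ : 0 < σ) (hl : 0 < l) :
    (∀ t, 0 < t → ∀ x ∈ Set.Ioo (0 : ℝ) l, Summable (fbTerm σ l t x)) ∧
    (∀ t, 0 < t → ∀ x ∈ Set.Ioo (0 : ℝ) l,
      DifferentiableAt ℝ (fbU σ l t) x ∧
      DifferentiableAt ℝ (deriv (fbU σ l t)) x ∧
      HasDerivAt (fun s => fbU σ l s x)
        (σ ^ 2 / 2 * x * deriv (deriv (fbU σ l t)) x + 3 * σ ^ 2 / 4 * deriv (fbU σ l t) x) t) ∧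
    (∀ t, 0 < t →
      Filter.Tendsto (fun x => fbU σ l t x) (nhdsWithin l (Set.Ioo (0 : ℝ) l)) (nhds 1)) ∧
    (∀ x ∈ Set.Ioo (0 : ℝ) l,
      Filter.Tendsto (fun t => fbU σ l t x) (nhdsWithin 0 (Set.Ioi (0 : ℝ))) (nhds 0)) := by
  have hc : 0 < σ ^ 2 * Real.pi ^ 2 / (8 * l) := by positivity
  refine ⟨fun t ht x _ ↦ ?_, fun t ht x hx ↦ ?_, fun t ht ↦ ?_, fun x hx ↦ ?_⟩
  · exact (summable_heatSine (mul_pos hc ht) _).congr fun m ↦ (fbTerm_eq σ l t x m).symm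
  · have h1 := hasDerivAt_fbU hσ hl ht hx.1
    have h2 := hasDerivAt_deriv_fbU hσ hl ht hx.1
    refine ⟨h1.differentiableAt, h2.differentiableAt, ?_⟩
    rw [h1.deriv, h2.deriv, show (fun s ↦ fbU σ l s x) = _ from funext (fbU_eq σ l · x)]
    have hs := (hasDerivAt_heatSine_time (mul_pos hc ht) (Real.sqrt (x / l))).comp t
      ((hasDerivAt_id t).const_mul (σ ^ 2 * Real.pi ^ 2 / (8 * l)))
    refine ((hs.const_mul (2 / Real.pi * (Real.sqrt (x / l))⁻¹)).const_add 1).congr_deriv ?_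
    have hy : 0 < Real.sqrt (x / l) := Real.sqrt_pos.2 (div_pos hx.1 hl)
    have hxy : x = l * Real.sqrt (x / l) ^ 2 := by
      rw [Real.sq_sqrt (div_pos hx.1 hl).le, mul_div_cancel₀ _ hl.ne']
    generalize Real.sqrt (x / l) = y at *
    rw [hxy]
    field_simp
    ring
  · have h := (hasDerivAt_fbU hσ hl ht hl).continuousAt.tendsto
    rw [fbU_eq, div_self hl.ne', Real.sqrt_one, heatSine_one, mul_zero, add_zero] at h
    exact h.mono_left nhdsWithin_le_nhds
  · have hy0 : 0 < Real.sqrt (x / l) := Real.sqrt_pos.2 (div_pos hx.1 hl)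
    have hy1 : Real.sqrt (x / l) < 1 := by
      rw [Real.sqrt_lt' one_pos, one_pow, div_lt_one hl]
      exact hx.2
    have htime : Tendsto (fun t ↦ σ ^ 2 * Real.pi ^ 2 / (8 * l) * t) (𝓝[>] 0) (𝓝[>] 0) := by
      refine tendsto_nhdsWithin_iff.2 ⟨?_, ?_⟩
      · simpa using (tendsto_id.const_mul (σ ^ 2 * Real.pi ^ 2 / (8 * l))).mono_left
          (nhdsWithin_le_nhds (a := (0 : ℝ)))
      · filter_upwards [self_mem_nhdsWithin] with t ht using mul_pos hc ht
    have h := (((tendsto_heatSine_zero hy0 hy1).comp htime).const_mul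
      (2 / Real.pi * (Real.sqrt (x / l))⁻¹)).const_add 1
    have hval : 1 + 2 / Real.pi * (Real.sqrt (x / l))⁻¹ * -(Real.pi * Real.sqrt (x / l) / 2) =
        0 := by
      field_simp
      ring
    rw [hval] at h
    exact h.congr fun t ↦ (fbU_eq σ l t x).symm
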